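/- Let V be a vertex operator algebra, O(V) the span of all u ∘ v for u, v ∈ V. Then the product u * v = Res_z ((1+z)^{wt u}/z) Y(u,z)v induces a well-defined associative product on A(V) = V/O(V). -/

import Mathlib

/-- Generalized binomial coefficient `C(n, k)` for `n : ℤ`, valued in `ℂ`. -/
noncomputable def cbinom (n : ℤ) (k : ℕ) : ℂ :=
  (∏ i ∈ Finset.range k, ((n : ℂ) - (i : ℂ))) / (Nat.factorial k : ℂ)

/-- A vertex operator algebra structure on a complex vector space `V`. -/
structure VOA (V : Type) [AddCommGroup V] [Module ℂ V] where
  mode : V → ℤ → Module.End ℂ V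
  vacuum : V
  conformal : V
  grading : ℤ → Submodule ℂ V
  internal : Function.Bijective (DirectSum.coeLinearMap grading)
  mode_add : ∀ (u v : V) (n : ℤ), mode (u + v) n = mode u n + mode v n
  mode_smul : ∀ (c : ℂ) (u : V) (n : ℤ), mode (c • u) n = c • mode u n
  truncation : ∀ u v : V, ∃ N : ℤ, ∀ n : ℤ, N ≤ n → mode u n v = 0
  vacuum_mem : vacuum ∈ grading 0
  conformal_mem : conformal ∈ grading 2
  vacuum_mode : ∀ (v : V) (n : ℤ), mode vacuum n v = if n = -1 then v else 0
  creation : ∀ (u : V) (n : ℤ), 0 ≤ n → mode u n vacuum = 0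
  creation_neg_one : ∀ u : V, mode u (-1) vacuum = u
  L0_eigen : ∀ (n : ℤ) (u : V), u ∈ grading n → mode conformal 1 u = (n : ℂ) • u
  Lneg1_deriv : ∀ (u : V) (n : ℤ), mode (mode conformal 0 u) n = (-n : ℂ) • mode u (n - 1)
  grading_mode : ∀ (r s m : ℤ) (u v : V), u ∈ grading r → v ∈ grading s →
    mode u m v ∈ grading (r + s - m - 1)
  bounded_below : ∃ N : ℤ, ∀ n : ℤ, n < N → grading n = ⊥
  fin_dim : ∀ n : ℤ, FiniteDimensional ℂ (grading n)
  borcherds : ∀ (p q r : ℤ) (u v w : V),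
    (∑ᶠ i : ℕ, cbinom p i • mode (mode u (r + i) v) (p + q - i) w) =
    ∑ᶠ i : ℕ, ((-1 : ℂ) ^ i * cbinom r i) •
      (mode u (p + r - i) (mode v (q + i) w)
        - (-1 : ℂ) ^ r • mode v (q + r - i) (mode u (p + i) w))

variable {V : Type} [AddCommGroup V] [Module ℂ V]

/-- Projection onto the weight-`n` subspace. -/
noncomputable def VOA.proj (d : VOA V) (n : ℤ) : V →ₗ[ℂ] V :=
  (d.grading n).subtype ∘ₗ (DirectSum.component ℂ ℤ (fun m => d.grading m) n) ∘ₗ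
    (LinearEquiv.ofBijective (DirectSum.coeLinearMap d.grading) d.internal).symm.toLinearMap

/-- `Res_z (1+z)^N z^{-k} Y(u,z)v` for a vector `u` regarded as having weight contribution `N`. -/
noncomputable def VOA.hres (d : VOA V) (N k : ℤ) (u v : V) : V :=
  ∑ᶠ i : ℕ, cbinom N i • d.mode u ((i : ℤ) - k) v

/-- `Res_z (1+z)^{wt u + m} z^{-k} Y(u,z)v`, extended bilinearly from homogeneous `u`. -/
noncomputable def VOA.bres (d : VOA V) (m k : ℤ) (u v : V) : V :=
  ∑ᶠ n : ℤ, d.hres (n + m) k (d.proj n u) v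

/-- The Zhu product `u * v`. -/
noncomputable def VOA.star (d : VOA V) (u v : V) : V := d.bres 0 1 u v

/-- The Zhu circle product `u ∘ v`. -/
noncomputable def VOA.circ (d : VOA V) (u v : V) : V := d.bres 0 2 u v

/-- The subspace `O(V)` spanned by all `u ∘ v`. -/
def VOA.Ozhu (d : VOA V) : Submodule ℂ V := Submodule.span ℂ {w : V | ∃ u v : V, w = d.circ u v}

/-- The product `u ∘_n v`. -/
noncomputable def VOA.circn (d : VOA V) (n : ℕ) (u v : V) : V := d.bres n (2 * n + 2) u v

/-- The product `u *_n v` of Dong–Li–Mason. -/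
noncomputable def VOA.starn (d : VOA V) (n : ℕ) (u v : V) : V :=
  ∑ m ∈ Finset.range (n + 1),
    ((-1 : ℂ) ^ m * cbinom ((m : ℤ) + (n : ℤ)) n) • d.bres n ((n : ℤ) + (m : ℤ) + 1) u v

/-- The subspace `O_n(V)`. -/
def VOA.On (d : VOA V) (n : ℕ) : Submodule ℂ V :=
  Submodule.span ℂ ({w : V | ∃ u v : V, w = d.circn n u v} ∪
    {w : V | ∃ u : V, w = d.mode d.conformal 0 u + d.mode d.conformal 1 u})

/-- The Dong–Jiang product `u *_{m,p}^n v`. -/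
noncomputable def VOA.starmpn (d : VOA V) (m p n : ℕ) (u v : V) : V :=
  ∑ i ∈ Finset.range (p + 1),
    ((-1 : ℂ) ^ i * cbinom ((m : ℤ) + (n : ℤ) - (p : ℤ) + (i : ℤ)) i) •
      d.bres m ((m : ℤ) + (n : ℤ) - (p : ℤ) + (i : ℤ) + 1) u v

/-- The Dong–Jiang product `u ∘_m^n v`. -/
noncomputable def VOA.circmn (d : VOA V) (n m : ℕ) (u v : V) : V :=
  d.bres m ((n : ℤ) + (m : ℤ) + 2) u v

/-- The subspace `O_{n,m}(V) = O'_{n,m}(V) + O''_{n,m}(V) + O'''_{n,m}(V)` of Dong–Jiang. -/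
def VOA.Onm (d : VOA V) (n m : ℕ) : Submodule ℂ V :=
  Submodule.span ℂ (
    {w : V | ∃ u v : V, w = d.circmn n m u v} ∪
    {w : V | ∃ u : V, w = d.mode d.conformal 0 u + d.mode d.conformal 1 u
        + (((m : ℂ) - (n : ℂ)) • u)} ∪
    {w : V | ∃ (u a b c : V) (p₁ p₂ p₃ : ℕ), w = d.starmpn m p₃ n u
        (d.starmpn m p₁ p₃ (d.starmpn p₁ p₂ p₃ a b) c
          - d.starmpn m p₂ p₃ a (d.starmpn m p₁ p₂ b c))} ∪
    {w : V | ∃ (p : ℕ) (u x v : V), x ∈ d.On p ∧ w = d.starmpn m p n (d.starmpn p p n u x) v})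

/-- The subspace `C_2(V)` spanned by the `u_{-2} v`. -/
def VOA.C2 (d : VOA V) : Submodule ℂ V := Submodule.span ℂ {w : V | ∃ u v : V, w = d.mode u (-2) v}

/-- `V` is a simple vertex operator algebra: its only ideals are `0` and `V`. -/
def VOA.IsSimpleVOA (d : VOA V) : Prop :=
  (∃ v : V, v ≠ 0) ∧ ∀ P : Submodule ℂ V,
    (∀ (u : V) (n : ℤ), ∀ w ∈ P, d.mode u n w ∈ P) → P = ⊥ ∨ P = ⊤

/-- A weak module for the vertex operator algebra `d`. -/
structure WeakMod (d : VOA V) (M : Type) [AddCommGroup M] [Module ℂ M] where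
  act : V → ℤ → Module.End ℂ M
  act_add : ∀ (u v : V) (n : ℤ), act (u + v) n = act u n + act v n
  act_smul : ∀ (c : ℂ) (u : V) (n : ℤ), act (c • u) n = c • act u n
  truncation : ∀ (u : V) (w : M), ∃ N : ℤ, ∀ n : ℤ, N ≤ n → act u n w = 0
  vacuum_act : ∀ (w : M) (n : ℤ), act d.vacuum n w = if n = -1 then w else 0
  borcherds : ∀ (p q r : ℤ) (u v : V) (w : M),
    (∑ᶠ i : ℕ, cbinom p i • act (d.mode u (r + i) v) (p + q - i) w) =
    ∑ᶠ i : ℕ, ((-1 : ℂ) ^ i * cbinom r i) •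
      (act u (p + r - i) (act v (q + i) w)
        - (-1 : ℂ) ^ r • act v (q + r - i) (act u (p + i) w))

/-- An admissible (ℤ₊-graded) module for the vertex operator algebra `d`. -/
structure AdmMod (d : VOA V) (M : Type) [AddCommGroup M] [Module ℂ M]
    extends WeakMod d M where
  gr : ℤ → Submodule ℂ M
  gr_internal : Function.Bijective (DirectSum.coeLinearMap gr)
  gr_neg : ∀ n : ℤ, n < 0 → gr n = ⊥
  gr_act : ∀ (r : ℤ) (u : V), u ∈ d.grading r → ∀ (m n : ℤ) (w : M), w ∈ gr n →
    act u m w ∈ gr (r + n - m - 1)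

variable {M : Type} [AddCommGroup M] [Module ℂ M]

/-- The zero-mode `o(v) = v_{wt v - 1}`, extended linearly from homogeneous `v`. -/
noncomputable def WeakMod.o {d : VOA V} (W : WeakMod d M) (v : V) (w : M) : M :=
  ∑ᶠ r : ℤ, W.act (d.proj r v) (r - 1) w

/-- The mode `o_t(v) = v_{wt v - 1 - t}`, extended linearly from homogeneous `v`. -/
noncomputable def WeakMod.ot {d : VOA V} (W : WeakMod d M) (t : ℤ) (v : V) (w : M) : M :=
  ∑ᶠ r : ℤ, W.act (d.proj r v) (r - 1 - t) w

/-- The subspace `Ω_n(M)` of a weak module. -/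
def WeakMod.OmegaSet {d : VOA V} (W : WeakMod d M) (n : ℕ) : Set M :=
  {w : M | ∀ (r : ℤ) (u : V), u ∈ d.grading r → ∀ m : ℤ, m > r - 1 + (n : ℤ) → W.act u m w = 0}

/-- A subspace stable under all modes. -/
def WeakMod.IsStable {d : VOA V} (W : WeakMod d M) (P : Submodule ℂ M) : Prop :=
  ∀ (u : V) (n : ℤ), ∀ w ∈ P, W.act u n w ∈ P

/-- A subspace compatible with the grading of an admissible module. -/
def AdmMod.IsGraded {d : VOA V} (A : AdmMod d M) (P : Submodule ℂ M) : Prop :=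
  P = ⨆ n : ℤ, (P ⊓ A.gr n)

/-- `P` is an irreducible admissible submodule. -/
def AdmMod.IrredSub {d : VOA V} (A : AdmMod d M) (P : Submodule ℂ M) : Prop :=
  P ≠ ⊥ ∧ A.toWeakMod.IsStable P ∧ A.IsGraded P ∧
    ∀ Q : Submodule ℂ M, Q ≤ P → A.toWeakMod.IsStable Q → A.IsGraded Q → Q = ⊥ ∨ Q = P

/-- The admissible module is irreducible. -/
def AdmMod.IsIrreducible {d : VOA V} (A : AdmMod d M) : Prop :=
  (∃ w : M, w ≠ 0) ∧
    ∀ P : Submodule ℂ M, A.toWeakMod.IsStable P → A.IsGraded P → P = ⊥ ∨ P = ⊤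

/-- Rationality: every admissible module is a direct sum of irreducible admissible submodules. -/
def Rational (d : VOA V) : Prop :=
  ∀ (M : Type) [AddCommGroup M] [Module ℂ M] (A : AdmMod d M),
    ∃ (ι : Type) (f : ι → Submodule ℂ M),
      (∀ i, A.IrredSub (f i)) ∧ iSupIndep f ∧ (⨆ i, f i) = ⊤

/-- Equivalence of admissible modules. -/
def AdmEquiv {d : VOA V} {M₁ M₂ : Type} [AddCommGroup M₁] [Module ℂ M₁]
    [AddCommGroup M₂] [Module ℂ M₂] (A₁ : AdmMod d M₁) (A₂ : AdmMod d M₂) : Prop :=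
  ∃ e : M₁ ≃ₗ[ℂ] M₂, ∀ (u : V) (n : ℤ) (w : M₁), e (A₁.act u n w) = A₂.act u n (e w)

/-- An ordinary-module structure on a weak module: a `ℂ`-grading by finite dimensional
`L(0)`-eigenspaces, bounded below in each coset of `ℤ`. -/
structure OrdinaryStruct {d : VOA V} (W : WeakMod d M) where
  grc : ℂ → Submodule ℂ M
  internal : Function.Bijective (DirectSum.coeLinearMap grc)
  eigen : ∀ (lam : ℂ) (w : M), w ∈ grc lam → W.act d.conformal 1 w = lam • w
  findim : ∀ lam : ℂ, FiniteDimensional ℂ (grc lam)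
  bounded : ∀ lam : ℂ, ∃ N : ℤ, ∀ n : ℤ, n < N → grc (lam + (n : ℂ)) = ⊥

/-- An admissible module is ordinary. -/
def AdmMod.IsOrdinary {d : VOA V} (A : AdmMod d M) : Prop :=
  Nonempty (OrdinaryStruct A.toWeakMod)

/-- A realization of the quotient associative algebra `V/Osub` with product induced by `mu`. -/
structure Realization (Osub : Submodule ℂ V) (mu : V → V → V) (one : V) where
  carrier : Type
  [ring : Ring carrier]
  [alg : Algebra ℂ carrier]
  emb : V →ₗ[ℂ] carrier
  surj : Function.Surjective emb
  ker_eq : LinearMap.ker emb = Osub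
  mul_compat : ∀ u v : V, emb (mu u v) = emb u * emb v
  one_compat : emb one = 1

/-- The realized algebra is semisimple. -/
def Realization.Semisimple {Osub : Submodule ℂ V} {mu : V → V → V} {one : V}
    (R : Realization Osub mu one) : Prop :=
  letI := R.ring; IsSemisimpleRing R.carrier

/-- The realized algebra is finite dimensional over `ℂ`. -/
def Realization.FinDim {Osub : Submodule ℂ V} {mu : V → V → V} {one : V}
    (R : Realization Osub mu one) : Prop :=
  letI := R.ring; letI := R.alg; FiniteDimensional ℂ R.carrier

/-- A module over the quotient algebra `V/Osub`, given as a representation of `V`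
killing `Osub` and multiplicative for `mu`. -/
structure RepOf (Osub : Submodule ℂ V) (mu : V → V → V) (one : V)
    (U : Type) [AddCommGroup U] [Module ℂ U] where
  rep : V →ₗ[ℂ] Module.End ℂ U
  kills : ∀ v ∈ Osub, rep v = 0
  mul_compat : ∀ u v : V, rep (mu u v) = rep u * rep v
  one_compat : rep one = 1

/-- Simplicity of such a representation. -/
def RepOf.IsSimple {Osub : Submodule ℂ V} {mu : V → V → V} {one : V}
    {U : Type} [AddCommGroup U] [Module ℂ U] (Z : RepOf Osub mu one U) : Prop :=
  (∃ u : U, u ≠ 0) ∧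
    ∀ P : Submodule ℂ U, (∀ v : V, ∀ x ∈ P, Z.rep v x ∈ P) → P = ⊥ ∨ P = ⊤

/-- Equivalence of two such representations. -/
def RepEquiv {Osub : Submodule ℂ V} {mu : V → V → V} {one : V}
    {U₁ U₂ : Type} [AddCommGroup U₁] [Module ℂ U₁] [AddCommGroup U₂] [Module ℂ U₂]
    (Z₁ : RepOf Osub mu one U₁) (Z₂ : RepOf Osub mu one U₂) : Prop :=
  ∃ e : U₁ ≃ₗ[ℂ] U₂, ∀ (v : V) (x : U₁), e (Z₁.rep v x) = Z₂.rep v (e x)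

theorem cbinom_eq_choose (n : ℤ) (k : ℕ) : cbinom n k = Ring.choose (n : ℂ) k := by
  have h : (descPochhammer ℤ k).smeval (n : ℂ) = ∏ i ∈ Finset.range k, ((n : ℂ) - i) := by
    induction k with
    | zero => simp
    | succ k ih =>
      rw [descPochhammer_succ_right, Polynomial.smeval_mul, ih, Finset.prod_range_succ]
      simp [Polynomial.smeval_natCast]
  rw [Ring.choose_eq_smul, h, cbinom, smul_eq_mul, div_eq_inv_mul]

@[simp]
theorem cbinom_zero_right (n : ℤ) : cbinom n 0 = 1 := by
  simp [cbinom]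

theorem cbinom_succ_succ (n : ℤ) (k : ℕ) :
    cbinom (n + 1) (k + 1) = cbinom n k + cbinom n (k + 1) := by
  simp only [cbinom_eq_choose, Int.cast_add, Int.cast_one, Ring.choose_succ_succ]

theorem succ_mul_cbinom_succ (n : ℤ) (k : ℕ) :
    ((k : ℂ) + 1) * cbinom n (k + 1) = ((n : ℂ) - k) * cbinom n k := by
  have h : (Nat.factorial k : ℂ) ≠ 0 := by exact_mod_cast Nat.factorial_ne_zero k
  have h' : (k : ℂ) + 1 ≠ 0 := by exact_mod_cast Nat.succ_ne_zero k
  simp only [cbinom, Finset.prod_range_succ, Nat.factorial_succ, Nat.cast_mul, Nat.cast_succ]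
  field_simp

theorem cbinom_eq_zero_of_lt {n k : ℕ} (h : n < k) : cbinom (n : ℤ) k = 0 := by
  simp [cbinom_eq_choose, Ring.choose_natCast, Nat.choose_eq_zero_of_lt h]

theorem cbinom_add_mul_cbinom (a : ℤ) (p i : ℕ) :
    cbinom a (i + p) * cbinom ((i + p : ℕ) : ℤ) i = cbinom a i * cbinom (a - i) p := by
  have := Ring.choose_smul_choose (a : ℂ) (Nat.le_add_right i p)
  simp only [cbinom_eq_choose, Int.cast_natCast, Ring.choose_natCast, Int.cast_sub]
  rw [Nat.add_sub_cancel_left] at this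
  rw [← this, nsmul_eq_mul, mul_comm]

theorem cbinom_add (a c : ℤ) (s : ℕ) :
    cbinom (a + c) s = ∑ x ∈ Finset.HasAntidiagonal.antidiagonal s, cbinom a x.1 * cbinom c x.2 := by
  simp only [cbinom_eq_choose, Int.cast_add]
  exact Ring.add_choose_eq s (Commute.all _ _)

theorem sum_range_sum_range_smul_add (f g : ℕ → ℂ) (x : ℕ → V) {S A B : ℕ} (hA : S ≤ A)
    (hB : S ≤ B) (hx : ∀ s, S ≤ s → x s = 0) :
    ∑ p ∈ Finset.range A, ∑ j ∈ Finset.range B, (f p * g j) • x (p + j) =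
      ∑ s ∈ Finset.range S, (∑ y ∈ Finset.HasAntidiagonal.antidiagonal s, f y.1 * g y.2) • x s := by
  rw [← Finset.sum_product', ← Finset.sum_filter_of_ne (p := fun y : ℕ × ℕ ↦ y.1 + y.2 < S),
    ← Finset.sum_fiberwise_of_maps_to (t := Finset.range S) (g := fun y : ℕ × ℕ ↦ y.1 + y.2)]
  · refine Finset.sum_congr rfl fun s hs ↦ ?_
    rw [Finset.sum_smul]
    have : Finset.filter (fun y : ℕ × ℕ ↦ y.1 + y.2 = s)
        (Finset.filter (fun y : ℕ × ℕ ↦ y.1 + y.2 < S) (Finset.range A ×ˢ Finset.range B)) =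
        Finset.HasAntidiagonal.antidiagonal s := by
      ext y
      simp only [Finset.mem_filter, Finset.mem_product, Finset.mem_range,
        Finset.HasAntidiagonal.mem_antidiagonal] at hs ⊢
      omega
    rw [this]
    refine Finset.sum_congr rfl fun y hy ↦ ?_
    rw [Finset.HasAntidiagonal.mem_antidiagonal.1 hy]
  · intro y hy
    simpa using (Finset.mem_filter.1 hy).2
  · intro y _ hy
    by_contra h
    exact hy (by rw [hx _ (not_lt.1 h), smul_zero])

namespace VOA

variable (d : VOA V)

theorem mode_zero (n : ℤ) : d.mode 0 n = 0 := by
  simpa using d.mode_smul 0 0 n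

theorem exists_mode_mode_eq_zero (u v w : V) (l : ℤ) :
    ∃ N : ℕ, ∀ n m : ℤ, (N : ℤ) ≤ n → l ≤ m → d.mode u n (d.mode v m w) = 0 := by
  obtain ⟨K, hK⟩ := d.truncation v w
  choose N hN using fun m : ℤ ↦ d.truncation u (d.mode v m w)
  refine ⟨∑ m ∈ Finset.Ico l K, (N m).toNat, fun n m hn hm ↦ ?_⟩
  rcases lt_or_ge m K with h | h
  · apply hN
    have := Finset.single_le_sum (f := fun m ↦ (N m).toNat) (fun _ _ ↦ Nat.zero_le _)
      (Finset.mem_Ico.2 ⟨hm, h⟩)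
    omega
  · rw [hK m h, map_zero]

theorem exists_mode_of_mode_eq_zero (u v w : V) (l : ℤ) :
    ∃ N : ℕ, ∀ n m : ℤ, (N : ℤ) ≤ n → l ≤ m → d.mode (d.mode u m v) n w = 0 := by
  obtain ⟨K, hK⟩ := d.truncation u v
  choose N hN using fun m : ℤ ↦ d.truncation (d.mode u m v) w
  refine ⟨∑ m ∈ Finset.Ico l K, (N m).toNat, fun n m hn hm ↦ ?_⟩
  rcases lt_or_ge m K with h | h
  · apply hN
    have := Finset.single_le_sum (f := fun m ↦ (N m).toNat) (fun _ _ ↦ Nat.zero_le _)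
      (Finset.mem_Ico.2 ⟨hm, h⟩)
    omega
  · rw [hK m h, d.mode_zero, LinearMap.zero_apply]

theorem exists_mode_eq_zero (u v : V) :
    ∃ N : ℕ, ∀ n : ℤ, (N : ℤ) ≤ n → d.mode u n v = 0 := by
  obtain ⟨N, hN⟩ := d.truncation u v
  exact ⟨N.toNat, fun n hn ↦ hN n (by omega)⟩

theorem hres_eq_sum {u v : V} {k : ℤ} {M : ℕ} (h : ∀ n : ℤ, M - k ≤ n → d.mode u n v = 0)
    (N : ℤ) :
    d.hres N k u v = ∑ i ∈ Finset.range M, cbinom N i • d.mode u (i - k) v := by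
  refine finsum_eq_sum_of_support_subset _ fun i hi ↦ ?_
  by_contra hM
  refine hi ?_
  simp only [Finset.coe_range, Set.mem_Iio, not_lt] at hM
  simp only
  rw [h _ (by omega), smul_zero]

theorem exists_hres_eq_sum (u v : V) (k : ℤ) :
    ∃ M₀ : ℕ, ∀ M, M₀ ≤ M → ∀ N : ℤ,
      d.hres N k u v = ∑ i ∈ Finset.range M, cbinom N i • d.mode u (i - k) v := by
  obtain ⟨N, hN⟩ := d.exists_mode_eq_zero u v
  exact ⟨N + k.toNat, fun M hM ↦ d.hres_eq_sum fun n hn ↦ hN n (by omega)⟩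

/-- `hres` as a bilinear map. -/
noncomputable def hresHom (N k : ℤ) : V →ₗ[ℂ] V →ₗ[ℂ] V :=
  LinearMap.mk₂ ℂ (d.hres N k)
    (fun u u' v ↦ by
      obtain ⟨A, hA⟩ := d.exists_hres_eq_sum u v k
      obtain ⟨B, hB⟩ := d.exists_hres_eq_sum u' v k
      obtain ⟨C, hC⟩ := d.exists_hres_eq_sum (u + u') v k
      rw [hA (A + B + C) (by omega), hB (A + B + C) (by omega), hC (A + B + C) (by omega),
        ← Finset.sum_add_distrib]
      simp [d.mode_add])
    (fun c u v ↦ by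
      simp only [hres, d.mode_smul, LinearMap.smul_apply, smul_finsum, smul_comm c])
    (fun u v v' ↦ by
      obtain ⟨A, hA⟩ := d.exists_hres_eq_sum u v k
      obtain ⟨B, hB⟩ := d.exists_hres_eq_sum u v' k
      obtain ⟨C, hC⟩ := d.exists_hres_eq_sum u (v + v') k
      rw [hA (A + B + C) (by omega), hB (A + B + C) (by omega), hC (A + B + C) (by omega),
        ← Finset.sum_add_distrib]
      simp)
    (fun c u v ↦ by
      simp only [hres, map_smul, smul_finsum, smul_comm c])

theorem hresHom_apply (N k : ℤ) (u v : V) : d.hresHom N k u v = d.hres N k u v := rfl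

theorem hres_zero_left (N k : ℤ) (v : V) : d.hres N k 0 v = 0 := by
  rw [← hresHom_apply, map_zero, LinearMap.zero_apply]

theorem hres_zero_right (N k : ℤ) (u : V) : d.hres N k u 0 = 0 := by
  rw [← hresHom_apply, map_zero]

theorem finite_support_proj (u : V) : (Function.support fun n ↦ d.proj n u).Finite := by
  classical
  refine ((LinearEquiv.ofBijective (DirectSum.coeLinearMap d.grading) d.internal).symm
    u).support.finite_toSet.subset fun n hn ↦ ?_
  simp only [Finset.mem_coe, DFinsupp.mem_support_toFun]
  intro h
  apply hn
  simp only [proj, DirectSum.component, LinearMap.comp_apply, LinearEquiv.coe_coe]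
  exact congrArg Subtype.val h

theorem proj_of_mem {a : ℤ} {u : V} (hu : u ∈ d.grading a) (n : ℤ) :
    d.proj n u = if n = a then u else 0 := by
  have h : (LinearEquiv.ofBijective (DirectSum.coeLinearMap d.grading) d.internal).symm u =
      DirectSum.lof ℂ ℤ (fun m ↦ d.grading m) a ⟨u, hu⟩ := by
    rw [LinearEquiv.symm_apply_eq]
    simp [DirectSum.coeLinearMap_lof]
  simp only [proj, LinearMap.comp_apply, LinearEquiv.coe_coe, h]
  split_ifs with hn
  · subst hn
    simp [DirectSum.component.lof_self]
  · rw [DirectSum.component.of, dif_neg (Ne.symm hn)]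
    simp

/-- `bres` as a bilinear map. -/
noncomputable def bresHom (m k : ℤ) : V →ₗ[ℂ] V →ₗ[ℂ] V :=
  have hfin : ∀ u v : V, (Function.support fun n ↦ d.hres (n + m) k (d.proj n u) v).Finite :=
    fun u v ↦ (d.finite_support_proj u).subset fun n hn h ↦ hn (by
      simp only at h ⊢
      rw [h, hres_zero_left])
  LinearMap.mk₂ ℂ (d.bres m k)
    (fun u u' v ↦ by
      simp only [bres]
      rw [← finsum_add_distrib (hfin u v) (hfin u' v)]
      simp only [← hresHom_apply, map_add, LinearMap.add_apply])
    (fun c u v ↦ by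
      simp only [bres, smul_finsum]
      simp only [← hresHom_apply, map_smul, LinearMap.smul_apply])
    (fun u v v' ↦ by
      simp only [bres]
      rw [← finsum_add_distrib (hfin u v) (hfin u v')]
      simp only [← hresHom_apply, map_add])
    (fun c u v ↦ by
      simp only [bres, smul_finsum]
      simp only [← hresHom_apply, map_smul])

theorem bresHom_apply (m k : ℤ) (u v : V) : d.bresHom m k u v = d.bres m k u v := rfl

theorem bres_of_mem {a : ℤ} {u : V} (hu : u ∈ d.grading a) (m k : ℤ) (v : V) :
    d.bres m k u v = d.hres (a + m) k u v := by
  rw [bres, finsum_eq_single _ a]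
  · simp [d.proj_of_mem hu]
  · intro n hn
    rw [d.proj_of_mem hu, if_neg hn, hres_zero_left]

theorem homogeneous_induction {P : V → Prop} (u : V)
    (hom : ∀ a, ∀ u ∈ d.grading a, P u) (add : ∀ u v, P u → P v → P (u + v)) : P u := by
  have : DirectSum.IsInternal d.grading := d.internal
  have hu : u ∈ iSup d.grading := this.submodule_iSup_eq_top ▸ Submodule.mem_top
  exact Submodule.iSup_induction d.grading (motive := P) hu hom (hom 0 0 (zero_mem _)) add

theorem circ_mem (u v : V) : d.circ u v ∈ d.Ozhu := Submodule.subset_span ⟨u, v, rfl⟩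

theorem hres_two_mem {a : ℤ} {u : V} (hu : u ∈ d.grading a) (v : V) :
    d.hres a 2 u v ∈ d.Ozhu := by
  have := d.circ_mem u v
  rwa [circ, d.bres_of_mem hu, add_zero] at this

theorem hres_succ (N k : ℤ) (u v : V) :
    d.hres (N + 1) k u v = d.hres N k u v + d.hres N (k - 1) u v := by
  obtain ⟨A, hA⟩ := d.exists_hres_eq_sum u v k
  obtain ⟨B, hB⟩ := d.exists_hres_eq_sum u v (k - 1)
  rw [hA (A + B + 1) (by omega), hA (A + B + 1) (by omega), hB (A + B) (by omega),
    Finset.sum_range_succ', Finset.sum_range_succ' _ (A + B), add_right_comm,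
    ← Finset.sum_add_distrib]
  congr 1
  refine Finset.sum_congr rfl fun i _ ↦ ?_
  rw [cbinom_succ_succ, add_smul, add_comm, show ((i + 1 : ℕ) : ℤ) - k = i - (k - 1) by
    push_cast; ring]

theorem hres_derivative (a k : ℤ) (u v : V) :
    d.hres (a + 1) k (d.mode d.conformal 0 u) v =
      (k : ℂ) • d.hres a (k + 1) u v + ((k : ℂ) - a - 1) • d.hres a k u v := by
  obtain ⟨A, hA⟩ := d.exists_hres_eq_sum (d.mode d.conformal 0 u) v k
  obtain ⟨B, hB⟩ := d.exists_hres_eq_sum u v (k + 1)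
  obtain ⟨C, hC⟩ := d.exists_hres_eq_sum u v k
  obtain ⟨M, hMA, hMB, hMC⟩ : ∃ M, A ≤ M ∧ B ≤ M ∧ C ≤ M :=
    ⟨A + B + C, by omega, by omega, by omega⟩
  rw [hA (M + 1) (by omega), hB (M + 1) (by omega), hC M hMC,
    Finset.sum_range_succ', Finset.sum_range_succ' _ M, smul_add,
    Finset.smul_sum, Finset.smul_sum, add_right_comm, ← Finset.sum_add_distrib]
  congr 1
  · refine Finset.sum_congr rfl fun i _ ↦ ?_
    rw [d.Lneg1_deriv, cbinom_succ_succ, show ((i + 1 : ℕ) : ℤ) - (k + 1) = i - k by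
      push_cast; ring, show ((i + 1 : ℕ) : ℤ) - k - 1 = i - k by push_cast; ring]
    simp only [LinearMap.smul_apply, smul_smul, ← add_smul]
    congr 1
    push_cast
    linear_combination -succ_mul_cbinom_succ a i
  · simp [d.Lneg1_deriv, sub_eq_add_neg, add_comm]

theorem hres_mem {a : ℤ} {u : V} (hu : u ∈ d.grading a) (v : V) (m : ℕ) :
    d.hres a (m + 2) u v ∈ d.Ozhu := by
  induction m generalizing a u with
  | zero => simpa using d.hres_two_mem hu v
  | succ m ih =>
    have hL : d.mode d.conformal 0 u ∈ d.grading (a + 1) := by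
      have := d.grading_mode 2 a 0 _ _ d.conformal_mem hu
      rwa [show (2 + a - 0 - 1 : ℤ) = a + 1 by ring] at this
    have h := d.hres_derivative a (m + 2) u v
    have hne : (((m + 2 : ℤ) : ℤ) : ℂ) ≠ 0 := by exact_mod_cast (by omega : (m + 2 : ℤ) ≠ 0)
    have h' := Submodule.sub_mem _ (ih hL) (Submodule.smul_mem _
      (((m + 2 : ℤ) : ℂ) - a - 1) (ih hu))
    rw [h, add_sub_cancel_right, Submodule.smul_mem_iff _ hne] at h'
    convert h' using 2
    push_cast
    ring

theorem hres_succ_mem {a : ℤ} {u : V} (hu : u ∈ d.grading a) (v : V) (m : ℕ) :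
    d.hres (a + 1) (m + 3) u v ∈ d.Ozhu := by
  rw [hres_succ]
  refine add_mem ?_ ?_
  · convert d.hres_mem hu v (m + 1) using 2
    push_cast
    ring
  · convert d.hres_mem hu v m using 2
    ring

/-- The residue in both variables of the Jacobi identity multiplied by
`(1 + z) ^ a * (1 + w) ^ c * w ^ (-l) * (z - w) ^ (-k)`. -/
theorem exists_sum_hres_eq (a c k l : ℤ) (u v w : V) :
    ∃ M : ℕ, 0 < M ∧ d.hres a k u v = ∑ i ∈ Finset.range M, cbinom a i • d.mode u (i - k) v ∧
      ∑ i ∈ Finset.range M, cbinom a i • d.hres (a + c - i) l (d.mode u (i - k) v) w =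
      ∑ i ∈ Finset.range M, ((-1 : ℂ) ^ i * cbinom (-k) i) •
        (d.hres a (k + i) u (d.hres c (l - i) v w)
          - (-1 : ℂ) ^ (-k) • d.hres c (l + k + i) v (d.hres a (-i) u w)) := by
  obtain ⟨Nuv, hNuv⟩ := d.exists_mode_eq_zero u v
  obtain ⟨Nvw, hNvw⟩ := d.exists_mode_eq_zero v w
  obtain ⟨Nuw, hNuw⟩ := d.exists_mode_eq_zero u w
  obtain ⟨N₁, hN₁⟩ := d.exists_mode_of_mode_eq_zero u v w (-k)
  obtain ⟨N₂, hN₂⟩ := d.exists_mode_mode_eq_zero u v w (-l)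
  obtain ⟨N₃, hN₃⟩ := d.exists_mode_mode_eq_zero v u w 0
  obtain ⟨I, hI₁, hI₂, hI₃⟩ : ∃ I : ℕ, (Nuv + k ≤ (I : ℤ)) ∧ (Nvw + l ≤ (I : ℤ)) ∧ Nuw ≤ I :=
    ⟨Nuv + Nvw + Nuw + k.natAbs + l.natAbs, by omega, by omega, by omega⟩
  obtain ⟨S, hS⟩ : ∃ S : ℕ, N₁ + l ≤ (S : ℤ) := ⟨N₁ + l.natAbs, by omega⟩
  obtain ⟨M, hM, hIM, hSM, hM₂, hM₃⟩ : ∃ M : ℕ, 0 < M ∧ I ≤ M ∧ S + I ≤ M ∧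
      (N₂ + k + I ≤ (M : ℤ)) ∧ (N₃ + l + k + I ≤ (M : ℤ)) :=
    ⟨S + I + N₂ + N₃ + k.natAbs + l.natAbs + 1, by omega, by omega, by omega, by omega, by omega⟩
  refine ⟨M, hM, d.hres_eq_sum (fun n hn ↦ hNuv n (by omega)) a, ?_⟩
  have borcherds : ∀ p j : ℕ,
      ∑ i ∈ Finset.range M,
        cbinom (p : ℤ) i • d.mode (d.mode u (i - k) v) ((p : ℤ) + j - i - l) w =
      ∑ i ∈ Finset.range M, ((-1 : ℂ) ^ i * cbinom (-k) i) •
        (d.mode u (p - (k + i)) (d.mode v (j - (l - i)) w)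
          - (-1 : ℂ) ^ (-k) • d.mode v (j - (l + k + i)) (d.mode u (p + i) w)) := by
    intro p j
    have h := d.borcherds p (j - l) (-k) u v w
    rw [finsum_eq_sum_of_support_subset (s := Finset.range M),
      finsum_eq_sum_of_support_subset (s := Finset.range M)] at h
    · convert h using 5 <;> first | ring1 | (congr 1; ring1) | (congr 2; ring1)
    · intro i hi
      by_contra hiM
      simp only [Finset.coe_range, Set.mem_Iio, not_lt] at hiM
      refine hi ?_
      simp only
      rw [hNvw _ (by omega), hNuw _ (by omega)]
      simp
    · intro i hi
      by_contra hiM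
      simp only [Finset.coe_range, Set.mem_Iio, not_lt] at hiM
      refine hi ?_
      simp only
      rw [hNuv _ (by omega), d.mode_zero]
      simp
  have lhs : ∀ i ∈ Finset.range M,
      cbinom a i • d.hres (a + c - i) l (d.mode u (i - k) v) w =
        ∑ p ∈ Finset.range M, ∑ j ∈ Finset.range M, (cbinom a p * cbinom c j) •
          cbinom (p : ℤ) i • d.mode (d.mode u (i - k) v) ((p : ℤ) + j - i - l) w := by
    intro i hi
    rw [Finset.mem_range] at hi
    rcases lt_or_ge i I with hiI | hiI
    · obtain ⟨L, rfl⟩ := Nat.exists_eq_add_of_le hi.le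
      rw [Finset.sum_range_add, Finset.sum_eq_zero, zero_add]
      · rw [d.hres_eq_sum (M := S) (fun n hn ↦ hN₁ n _ (by omega) (by omega)),
          show a + c - i = (a - i) + c by ring]
        simp only [cbinom_add]
        rw [← sum_range_sum_range_smul_add (A := L) (B := i + L) _ _
          (fun s : ℕ ↦ d.mode (d.mode u (i - k) v) (s - l) w) (by omega) (by omega)
          (fun s hs ↦ hN₁ _ _ (by omega) (by omega))]
        simp only [Finset.smul_sum]
        refine Finset.sum_congr rfl fun p _ ↦ Finset.sum_congr rfl fun j _ ↦ ?_
        rw [smul_smul, smul_smul, mul_right_comm, cbinom_add_mul_cbinom, mul_assoc]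
        congr 3
        push_cast
        ring
      · intro p hp
        rw [Finset.mem_range] at hp
        simp [cbinom_eq_zero_of_lt hp]
    · rw [hNuv _ (by omega)]
      simp [d.hres_zero_left, d.mode_zero]
  have rhs₁ : ∀ i : ℕ, d.hres a (k + i) u (d.hres c (l - i) v w) =
      ∑ p ∈ Finset.range M, ∑ j ∈ Finset.range M, (cbinom a p * cbinom c j) •
        d.mode u (p - (k + i)) (d.mode v (j - (l - i)) w) := by
    intro i
    rw [d.hres_eq_sum (M := M) (fun n hn ↦ hNvw n (by omega)) c]
    simp only [← hresHom_apply, map_sum, map_smul]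
    simp only [hresHom_apply]
    rw [Finset.sum_comm]
    refine Finset.sum_congr rfl fun j _ ↦ ?_
    rcases lt_or_ge i I with hiI | hiI
    · rw [d.hres_eq_sum (M := M) (fun n hn ↦ hN₂ n _ (by omega) (by omega)), Finset.smul_sum]
      simp only [smul_smul, mul_comm]
    · rw [hNvw _ (by omega)]
      simp [d.hres_zero_right]
  have rhs₂ : ∀ i : ℕ, d.hres c (l + k + i) v (d.hres a (-i) u w) =
      ∑ p ∈ Finset.range M, ∑ j ∈ Finset.range M, (cbinom a p * cbinom c j) •
        d.mode v (j - (l + k + i)) (d.mode u (p + i) w) := by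
    intro i
    rw [d.hres_eq_sum (M := M) (fun n hn ↦ hNuw n (by omega)) a]
    simp only [← hresHom_apply, map_sum, map_smul]
    simp only [hresHom_apply, sub_neg_eq_add]
    refine Finset.sum_congr rfl fun p _ ↦ ?_
    rcases lt_or_ge i I with hiI | hiI
    · rw [d.hres_eq_sum (M := M) (fun n hn ↦ hN₃ n _ (by omega) (by omega)), Finset.smul_sum]
      simp only [smul_smul]
    · rw [hNuw _ (by omega)]
      simp [d.hres_zero_right]
  have rhs : ∀ i ∈ Finset.range M, ((-1 : ℂ) ^ i * cbinom (-k) i) •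
      (d.hres a (k + i) u (d.hres c (l - i) v w)
        - (-1 : ℂ) ^ (-k) • d.hres c (l + k + i) v (d.hres a (-i) u w)) =
      ∑ p ∈ Finset.range M, ∑ j ∈ Finset.range M, (cbinom a p * cbinom c j) •
        ((-1 : ℂ) ^ i * cbinom (-k) i) •
          (d.mode u (p - (k + i)) (d.mode v (j - (l - i)) w)
            - (-1 : ℂ) ^ (-k) • d.mode v (j - (l + k + i)) (d.mode u (p + i) w)) := by
    intro i _
    rw [rhs₁, rhs₂, Finset.smul_sum, ← Finset.sum_sub_distrib, Finset.smul_sum]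
    refine Finset.sum_congr rfl fun p _ ↦ ?_
    rw [Finset.smul_sum, ← Finset.sum_sub_distrib, Finset.smul_sum]
    refine Finset.sum_congr rfl fun j _ ↦ ?_
    rw [smul_comm (cbinom a p * cbinom c j), smul_sub (cbinom a p * cbinom c j),
      smul_comm (cbinom a p * cbinom c j)]
  have sum_rotate : ∀ f : ℕ → ℕ → ℕ → V,
      ∑ i ∈ Finset.range M, ∑ p ∈ Finset.range M, ∑ j ∈ Finset.range M, f i p j =
        ∑ p ∈ Finset.range M, ∑ j ∈ Finset.range M, ∑ i ∈ Finset.range M, f i p j := fun f ↦ by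
    rw [Finset.sum_comm]
    exact Finset.sum_congr rfl fun p _ ↦ Finset.sum_comm
  rw [Finset.sum_congr rfl lhs, Finset.sum_congr rfl rhs]
  refine (sum_rotate _).trans (Eq.trans ?_ (sum_rotate _).symm)
  refine Finset.sum_congr rfl fun p _ ↦ Finset.sum_congr rfl fun j _ ↦ ?_
  rw [← Finset.smul_sum, borcherds, Finset.smul_sum]

theorem bres_hres_of_mem {a b k l : ℤ} {u v : V} (hu : u ∈ d.grading a) (hv : v ∈ d.grading b)
    {M : ℕ} (hM : d.hres a k u v = ∑ i ∈ Finset.range M, cbinom a i • d.mode u (i - k) v)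
    (w : V) :
    d.bres 0 l (d.hres a k u v) w = ∑ i ∈ Finset.range M,
      cbinom a i • d.hres (a + (b + k - 1) - i) l (d.mode u (i - k) v) w := by
  rw [hM, ← bresHom_apply]
  simp only [map_sum, map_smul, LinearMap.sum_apply, LinearMap.smul_apply, bresHom_apply]
  refine Finset.sum_congr rfl fun i _ ↦ ?_
  rw [d.bres_of_mem (d.grading_mode a b (i - k) u v hu hv)]
  congr 2
  ring

theorem bres_star_sub_star_bres_mem {a b : ℤ} {u v : V} (hu : u ∈ d.grading a) (hv : v ∈ d.grading b)
    (l : ℕ) (w : V) :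
    d.bres 0 (l + 1) (d.star u v) w - d.star u (d.bres 0 (l + 1) v w) ∈ d.Ozhu := by
  have hs : d.star u v = d.hres a 1 u v := by rw [star, d.bres_of_mem hu, add_zero]
  obtain ⟨M, hM, hM₁, h⟩ := d.exists_sum_hres_eq a (b + 1 - 1) 1 (l + 1) u v w
  obtain ⟨M, rfl⟩ := Nat.exists_eq_succ_of_ne_zero hM.ne'
  rw [hs, d.bres_hres_of_mem hu hv hM₁, h, star, d.bres_of_mem hu, d.bres_of_mem hv]
  have hv' : ∀ (i : ℕ) (x : V), d.hres b (l + 1 + 1 + i) v x ∈ d.Ozhu := fun i x ↦ by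
    convert d.hres_mem hv x (l + i) using 2
    push_cast
    ring
  have hu' : ∀ (i : ℕ) (x : V), d.hres a (1 + (i + 1 : ℕ)) u x ∈ d.Ozhu := fun i x ↦ by
    convert d.hres_mem hu x i using 2
    push_cast
    ring
  rw [Finset.sum_range_succ', add_sub_cancel_right, add_sub_assoc]
  refine add_mem (sum_mem fun i _ ↦ Submodule.smul_mem _ _
    (sub_mem (hu' _ _) (Submodule.smul_mem _ _ (hv' _ _)))) ?_
  have := Submodule.smul_mem _ ((-1 : ℂ) ^ (-1 : ℤ)) (hv' 0 (d.hres a (-(0 : ℕ)) u w))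
  convert neg_mem this using 1
  simp

theorem star_assoc (u v w : V) : d.star (d.star u v) w - d.star u (d.star v w) ∈ d.Ozhu := by
  induction u using d.homogeneous_induction with
  | add u u' h h' =>
    convert add_mem h h' using 1
    simp only [star, ← bresHom_apply, map_add, LinearMap.add_apply]
    abel
  | hom a u hu =>
    induction v using d.homogeneous_induction with
    | add v v' h h' =>
      convert add_mem h h' using 1
      simp only [star, ← bresHom_apply, map_add, LinearMap.add_apply]
      abel
    | hom b v hv => simpa [star] using d.bres_star_sub_star_bres_mem hu hv 0 w

theorem star_circ_mem (u v w : V) : d.star u (d.circ v w) ∈ d.Ozhu := by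
  induction u using d.homogeneous_induction with
  | add u u' h h' =>
    convert add_mem h h' using 1
    simp only [star, ← bresHom_apply, map_add, LinearMap.add_apply]
  | hom a u hu =>
    induction v using d.homogeneous_induction with
    | add v v' h h' =>
      convert add_mem h h' using 1
      simp only [star, circ, ← bresHom_apply, map_add, LinearMap.add_apply]
    | hom b v hv =>
      have h := d.bres_star_sub_star_bres_mem hu hv 1 w
      exact (Submodule.sub_mem_iff_right _ (d.circ_mem (d.star u v) w)).1 h

theorem circ_star_mem (u v w : V) : d.star (d.circ u v) w ∈ d.Ozhu := by
  induction u using d.homogeneous_induction with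
  | add u u' h h' =>
    convert add_mem h h' using 1
    simp only [star, circ, ← bresHom_apply, map_add, LinearMap.add_apply]
  | hom a u hu =>
    induction v using d.homogeneous_induction with
    | add v v' h h' =>
      convert add_mem h h' using 1
      simp only [star, circ, ← bresHom_apply, map_add, LinearMap.add_apply]
    | hom b v hv =>
      have hs : d.circ u v = d.hres a 2 u v := by rw [circ, d.bres_of_mem hu, add_zero]
      obtain ⟨M, -, hM, h⟩ := d.exists_sum_hres_eq a (b + 2 - 1) 2 1 u v w
      rw [hs, star, d.bres_hres_of_mem hu hv hM, h]
      refine sum_mem fun i _ ↦ Submodule.smul_mem _ _ (sub_mem ?_ (Submodule.smul_mem _ _ ?_))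
      · rw [add_comm]
        exact d.hres_mem hu _ i
      · convert d.hres_succ_mem hv _ i using 2 <;> ring

theorem star_mem_right (u : V) {x : V} (hx : x ∈ d.Ozhu) : d.star u x ∈ d.Ozhu := by
  suffices d.Ozhu ≤ d.Ozhu.comap (d.bresHom 0 1 u) from this hx
  refine Submodule.span_le.2 ?_
  rintro _ ⟨v, w, rfl⟩
  exact d.star_circ_mem u v w

theorem star_mem_left {x : V} (hx : x ∈ d.Ozhu) (w : V) : d.star x w ∈ d.Ozhu := by
  suffices d.Ozhu ≤ d.Ozhu.comap ((d.bresHom 0 1).flip w) from this hx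
  refine Submodule.span_le.2 ?_
  rintro _ ⟨u, v, rfl⟩
  exact d.circ_star_mem u v w

/-- The product on Zhu's algebra `V / O(V)` induced by `star`. -/
noncomputable def zhuMul : (V ⧸ d.Ozhu) →ₗ[ℂ] (V ⧸ d.Ozhu) →ₗ[ℂ] (V ⧸ d.Ozhu) :=
  d.Ozhu.liftQ
    (d.Ozhu.liftQ ((d.bresHom 0 1).compr₂ d.Ozhu.mkQ).flip (fun x hx ↦ by
      rw [LinearMap.mem_ker]
      ext u
      exact (Submodule.Quotient.mk_eq_zero _).2 (d.star_mem_right u hx))).flip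
    (fun x hx ↦ by
      rw [LinearMap.mem_ker]
      ext w
      exact (Submodule.Quotient.mk_eq_zero _).2 (d.star_mem_left hx w))

theorem zhuMul_mkQ (u v : V) :
    d.zhuMul (d.Ozhu.mkQ u) (d.Ozhu.mkQ v) = d.Ozhu.mkQ (d.star u v) := rfl

end VOA

/-- the product `*` induces a well-defined associative product on
`A(V) = V/O(V)`. -/
theorem stmt1 (d : VOA V) :
    ∃ mul : (V ⧸ d.Ozhu) →ₗ[ℂ] (V ⧸ d.Ozhu) →ₗ[ℂ] (V ⧸ d.Ozhu),
      (∀ a b c : V ⧸ d.Ozhu, mul (mul a b) c = mul a (mul b c)) ∧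
      ∀ u v : V, mul (d.Ozhu.mkQ u) (d.Ozhu.mkQ v) = d.Ozhu.mkQ (d.star u v) := by
  refine ⟨d.zhuMul, fun a b c ↦ ?_, d.zhuMul_mkQ⟩
  obtain ⟨u, rfl⟩ := d.Ozhu.mkQ_surjective a
  obtain ⟨v, rfl⟩ := d.Ozhu.mkQ_surjective b
  obtain ⟨w, rfl⟩ := d.Ozhu.mkQ_surjective c
  simp only [d.zhuMul_mkQ]
  exact (Submodule.Quotient.eq _).2 (d.star_assoc u v w)
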